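/- arXiv:2107.14214 — 3 statements merged into one kernel-verified Lean document; each statement's English description precedes it below -/
import Mathlib

section
/- (Proposition 2.5) Let M be a cyclic k-matroid on ℤ_n with 1 ≤ k ≤ n. Then the set B₀ = {0, 1, …, k−1} is a base of M. -/
/-- The interval `B_i = {i, i+1, …, i+k-1}` viewed inside `ZMod n`. -/
def cyclicInterval (n : ℕ) (k i : ℤ) : Set (ZMod n) :=
  (fun t : ℤ => (t : ZMod n)) '' Set.Ico i (i + k)

/-- Independence in a translation-invariant matroid is translation-invariant. -/
theorem Matroid.Indep.image_add_right {G : Type*} [Add G] {M : Matroid G}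
    (hcyclic : ∀ B, M.IsBase B → ∀ s : G, M.IsBase ((fun a => a + s) '' B))
    {I : Set G} (hI : M.Indep I) (s : G) : M.Indep ((fun a => a + s) '' I) := by
  obtain ⟨B, hB, hIB⟩ := hI.exists_isBase_superset
  exact (hcyclic B hB s).indep.subset (Set.image_mono hIB)

/-- If `{0, …, m-1}` is independent but `{0, …, m}` is not, then `{0, …, m-1}` spans. -/
theorem natCast_mem_closure_of_not_indep {n m : ℕ} {M : Matroid (ZMod n)} (hE : M.E = Set.univ)
    (hcyclic : ∀ B, M.IsBase B → ∀ s : ZMod n, M.IsBase ((fun a => a + s) '' B))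
    (hI : M.Indep ((Nat.cast : ℕ → ZMod n) '' Set.Iio m))
    (hI' : ¬ M.Indep (insert (m : ZMod n) ((Nat.cast : ℕ → ZMod n) '' Set.Iio m))) (t : ℕ) :
    (t : ZMod n) ∈ M.closure ((Nat.cast : ℕ → ZMod n) '' Set.Iio m) := by
  induction t using Nat.strong_induction_on with
  | _ t ih =>
    rcases lt_or_ge t m with htm | htm
    · exact M.mem_closure_of_mem (Set.mem_image_of_mem _ htm) (by simp [hE])
    · obtain ⟨s, rfl⟩ := Nat.exists_eq_add_of_le htm
      have hsub : (fun a => a + (s : ZMod n)) '' ((Nat.cast : ℕ → ZMod n) '' Set.Iio m) ⊆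
          M.closure ((Nat.cast : ℕ → ZMod n) '' Set.Iio m) := by
        rintro _ ⟨_, ⟨i, hi, rfl⟩, rfl⟩
        have := ih (i + s) (Nat.add_lt_add_right hi s)
        push_cast at this
        exact this
      refine M.closure_subset_closure_of_subset_closure hsub ?_
      by_contra hmem
      have hins := ((hI.image_add_right hcyclic (s : ZMod n)).notMem_closure_iff
        (by simp [hE])).1 hmem
      have hback := hins.1.image_add_right hcyclic (-(s : ZMod n))
      refine hI' ?_
      simpa [Set.image_insert_eq, Set.image_image] using hback

/-- (Proposition 2.5) If `M` is a cyclic `k`-matroid on `ℤ_n` (with `1 ≤ k ≤ n`),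
then `B₀ = {0, 1, …, k-1}` is a base of `M`. -/
theorem cyclic_matroid_interval_base (n k : ℕ) (hn : 0 < n) (hk : 1 ≤ k) (hkn : k ≤ n)
    (M : Matroid (ZMod n)) (hE : M.E = Set.univ)
    (hrank : ∀ B, M.IsBase B → B.ncard = k)
    (hcyclic : ∀ B, M.IsBase B → ∀ s : ZMod n, M.IsBase ((fun a => a + s) '' B)) :
    M.IsBase (cyclicInterval n k 0) := by
  have : NeZero n := ⟨hn.ne'⟩
  have hindep : ∀ m ≤ k, M.Indep ((Nat.cast : ℕ → ZMod n) '' Set.Iio m) := by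
    intro m
    induction m with
    | zero => intro _; simp
    | succ m ih =>
      intro hm
      have hI := ih (by omega)
      rw [← Order.succ_eq_add_one, Order.Iio_succ_eq_insert, Set.image_insert_eq]
      by_contra hI'
      have hbase : M.IsBase ((Nat.cast : ℕ → ZMod n) '' Set.Iio m) := by
        refine hI.isBase_of_ground_subset_closure fun x _ => ?_
        rw [← ZMod.natCast_zmod_val x]
        exact natCast_mem_closure_of_not_indep hE hcyclic hI hI' x.val
      have hle : ((Nat.cast : ℕ → ZMod n) '' Set.Iio m).ncard ≤ (Set.Iio m).ncard :=
        Set.ncard_image_le (Set.finite_Iio m)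
      rw [hrank _ hbase, Set.ncard_Iio_nat] at hle
      omega
  have hcard : ((Nat.cast : ℕ → ZMod n) '' Set.Iio k).ncard = k := by
    rw [Set.InjOn.ncard_image, Set.ncard_Iio_nat]
    intro a ha b hb hab
    rw [Set.mem_Iio] at ha hb
    rwa [ZMod.natCast_eq_natCast_iff', Nat.mod_eq_of_lt (by omega),
      Nat.mod_eq_of_lt (by omega)] at hab
  have hinterval : cyclicInterval n k 0 = (Nat.cast : ℕ → ZMod n) '' Set.Iio k := by
    ext x
    constructor
    · rintro ⟨t, ⟨h0, ht⟩, rfl⟩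
      lift t to ℕ using h0
      exact ⟨t, by simpa using ht, by simp⟩
    · rintro ⟨t, ht, rfl⟩
      exact ⟨t, ⟨by simp, by simpa using ht⟩, by simp⟩
  obtain ⟨B, hB, hIB⟩ := (hindep k le_rfl).exists_isBase_superset
  rw [hinterval, Set.eq_of_subset_of_ncard_le hIB (by rw [hrank B hB, hcard]) B.toFinite]
  exact hB
end

section
/- (Proposition 3.4) Let M be a cyclic k-matroid on ℤ_n with 1 ≤ k < n, and let Q be a nonempty subset of B₀ = {0,…,k−1} with cardinality r. Let q₁ and q₂ be respectively the smallest and largest integers in {0,…,k−1} whose residues lie in Q, and assume q₂ − q₁ < n − k. Let m = ⌊(n − k − (q₂ − q₁) − 1)/(k − r + 1)⌋ + 1. Then the set of bases B of M such that B₀ \ Q ⊆ B and B ⊆ (B₀ \ Q) ∪ (B_{q₁+i} \ B₀) for some integer i with q₂ − q₁ < i ≤ n − k has cardinality at least m. -/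
theorem ncard_cyclicInterval_le (n : ℕ) (k i : ℤ) : (cyclicInterval n k i).ncard ≤ k.toNat := by
  refine (Set.ncard_image_le (Set.finite_Ico _ _)).trans ?_
  rw [← Finset.coe_Ico, Set.ncard_coe_finset, Int.card_Ico, add_sub_cancel_left]

theorem ncard_cyclicInterval (n k : ℕ) (hkn : k ≤ n) (i : ℤ) :
    (cyclicInterval n k i).ncard = k := by
  rw [cyclicInterval, Set.InjOn.ncard_image, ← Finset.coe_Ico, Set.ncard_coe_finset, Int.card_Ico]
  · simp
  · intro a ha b hb hab
    simp only [Set.mem_Ico] at ha hb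
    have hdvd := (ZMod.intCast_eq_intCast_iff_dvd_sub a b n).1 hab
    have := Int.eq_zero_of_abs_lt_dvd hdvd (by rw [abs_lt]; omega)
    omega

theorem image_add_cyclicInterval (n : ℕ) (k i s : ℤ) :
    (fun a => a + (s : ZMod n)) '' cyclicInterval n k i = cyclicInterval n k (i + s) := by
  have hIco : Set.Ico (i + s) (i + s + k) = (fun t => t + s) '' Set.Ico i (i + k) := by
    rw [Set.image_add_const_Ico]
    congr 1
    ring
  rw [cyclicInterval, cyclicInterval, hIco, Set.image_image, Set.image_image]
  simp

theorem cyclicInterval_succ (n : ℕ) (j : ℕ) (i : ℤ) :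
    cyclicInterval n ((j + 1 : ℕ) : ℤ) i =
      insert (((i + j : ℤ)) : ZMod n) (cyclicInterval n j i) := by
  rw [cyclicInterval, cyclicInterval, ← Set.image_insert_eq]
  congr 1
  ext t
  simp only [Set.mem_Ico, Set.mem_insert_iff]
  omega

section CyclicMatroid

variable {n : ℕ} {M : Matroid (ZMod n)}

theorem Matroid.Indep.image_add_of_cyclic
    (hcyclic : ∀ B, M.IsBase B → ∀ s : ZMod n, M.IsBase ((fun a => a + s) '' B))
    {I : Set (ZMod n)} (hI : M.Indep I) (s : ZMod n) : M.Indep ((fun a => a + s) '' I) := by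
  obtain ⟨B, hB, hIB⟩ := hI.exists_isBase_superset
  exact (hcyclic B hB s).indep.subset (Set.image_mono hIB)

theorem indep_cyclicInterval_of_cyclic
    (hcyclic : ∀ B, M.IsBase B → ∀ s : ZMod n, M.IsBase ((fun a => a + s) '' B))
    {k i : ℤ} (h : M.Indep (cyclicInterval n k i)) (j : ℤ) : M.Indep (cyclicInterval n k j) := by
  have := h.image_add_of_cyclic hcyclic ((j - i : ℤ) : ZMod n)
  rwa [image_add_cyclicInterval, add_sub_cancel] at this

/-- If `j` consecutive residues are independent but `j + 1` are not, then the former form a base. -/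
theorem isBase_cyclicInterval_of_not_indep_succ [NeZero n] (hE : M.E = Set.univ)
    (hcyclic : ∀ B, M.IsBase B → ∀ s : ZMod n, M.IsBase ((fun a => a + s) '' B))
    {j : ℕ} (hj : M.Indep (cyclicInterval n j 0))
    (hj' : ¬ M.Indep (cyclicInterval n ((j + 1 : ℕ) : ℤ) 0)) :
    M.IsBase (cyclicInterval n j 0) := by
  have hstep (s : ℤ) : ((s + j : ℤ) : ZMod n) ∈ M.closure (cyclicInterval n j s) := by
    by_contra hmem
    have hs := indep_cyclicInterval_of_cyclic hcyclic hj s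
    have hins := (hs.notMem_closure_iff (by simp [hE])).1 hmem
    rw [← cyclicInterval_succ] at hins
    exact hj' (indep_cyclicInterval_of_cyclic hcyclic hins.1 0)
  have hmem (t : ℕ) : (t : ZMod n) ∈ M.closure (cyclicInterval n j 0) := by
    induction t using Nat.strong_induction_on with
    | _ t ih =>
      rcases lt_or_ge t j with htj | htj
      · refine M.mem_closure_of_mem ⟨t, by simp [htj], by simp⟩ (by simp [hE])
      · have hsub : cyclicInterval n j ((t - j : ℕ) : ℤ) ⊆ M.closure (cyclicInterval n j 0) := by
          rintro _ ⟨u, hu, rfl⟩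
          simp only [Set.mem_Ico] at hu
          lift u to ℕ using by omega
          simpa using ih u (by omega)
        have := M.closure_subset_closure_of_subset_closure hsub (hstep ((t - j : ℕ) : ℤ))
        rwa [← Nat.cast_add, Nat.sub_add_cancel htj, Int.cast_natCast] at this
  refine hj.isBase_of_ground_subset_closure fun x _ => ?_
  simpa using hmem x.val

theorem isBase_cyclicInterval [NeZero n] {k : ℕ} (hkn : k ≤ n) (hE : M.E = Set.univ)
    (hrank : ∀ B, M.IsBase B → B.ncard = k)
    (hcyclic : ∀ B, M.IsBase B → ∀ s : ZMod n, M.IsBase ((fun a => a + s) '' B)) (i : ℤ) :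
    M.IsBase (cyclicInterval n k i) := by
  have hindep (j : ℕ) (hjk : j ≤ k) : M.Indep (cyclicInterval n j 0) := by
    induction j with
    | zero => simp [cyclicInterval]
    | succ j ih =>
      by_contra hdep
      have hbase := isBase_cyclicInterval_of_not_indep_succ hE hcyclic (ih (by omega)) hdep
      have hcard := hrank _ hbase
      rw [ncard_cyclicInterval n j (by omega)] at hcard
      omega
  obtain ⟨B, hB, hIB⟩ :=
    (indep_cyclicInterval_of_cyclic hcyclic (hindep k le_rfl) i).exists_isBase_superset
  rwa [Set.eq_of_subset_of_ncard_le hIB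
    (by rw [hrank B hB, ncard_cyclicInterval n k hkn]) (Set.toFinite B)]

end CyclicMatroid

/-- Modulo `B₀`, two windows intersect as the corresponding integer intervals do. -/
theorem cyclicInterval_diff_inter_subset {n k : ℕ} {s s' : ℤ} (hs : 0 ≤ s) (hs' : 0 ≤ s')
    (hsn : s ≤ n) (hsn' : s' ≤ n) :
    (cyclicInterval n k s \ cyclicInterval n k 0) ∩ (cyclicInterval n k s' \ cyclicInterval n k 0)
      ⊆ cyclicInterval n (s + k - s') s' := by
  have hlift (t : ℤ) (h0 : 0 ≤ t) (ht : t < n + k)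
      (hB : (t : ZMod n) ∉ cyclicInterval n k 0) : t < n ∧ k ≤ t := by
    constructor
    · by_contra! h
      exact hB ⟨t - n, by simp only [Set.mem_Ico]; omega, by simp⟩
    · by_contra! h
      exact hB ⟨t, by simp only [Set.mem_Ico]; omega, rfl⟩
  rintro _ ⟨⟨⟨t, ht, rfl⟩, htB⟩, ⟨⟨u, hu, hut⟩, -⟩⟩
  simp only [Set.mem_Ico] at ht hu hut
  have h1 := hlift t (by omega) (by omega) htB
  have h2 := hlift u (by omega) (by omega) (by rw [hut]; exact htB)
  have hdvd := (ZMod.intCast_eq_intCast_iff_dvd_sub u t n).1 hut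
  have := Int.eq_zero_of_abs_lt_dvd hdvd (by rw [abs_lt]; omega)
  exact ⟨t, by simp only [Set.mem_Ico]; omega, rfl⟩


/-- (Proposition 3.4) In a cyclic `k`-matroid on `ℤ_n`, for a nonempty `Q ⊆ B₀` with
`|Q| = r` and `q₂ - q₁ < n - k`, there are at least `⌊(n-k-(q₂-q₁)-1)/(k-r+1)⌋ + 1`
bases `B` with `B₀ \ Q ⊆ B ⊆ (B₀ \ Q) ∪ (B_{q₁+i} \ B₀)` for some `q₂ - q₁ < i ≤ n - k`. -/
theorem exists_bases_exchange (n k : ℕ) (hn : 0 < n) (hk : 1 ≤ k) (hkn : k < n)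
    (M : Matroid (ZMod n)) (hE : M.E = Set.univ)
    (hrank : ∀ B, M.IsBase B → B.ncard = k)
    (hcyclic : ∀ B, M.IsBase B → ∀ s : ZMod n, M.IsBase ((fun a => a + s) '' B))
    (Q : Set (ZMod n)) (hQsub : Q ⊆ cyclicInterval n k 0) (hQne : Q.Nonempty)
    (r : ℕ) (hr : Q.ncard = r)
    (q₁ q₂ : ℤ)
    (hq₁mem : q₁ ∈ Set.Ico 0 (k : ℤ)) (hq₁Q : (q₁ : ZMod n) ∈ Q)
    (hq₁min : ∀ t ∈ Set.Ico 0 (k : ℤ), ((t : ZMod n) ∈ Q) → q₁ ≤ t)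
    (hq₂mem : q₂ ∈ Set.Ico 0 (k : ℤ)) (hq₂Q : (q₂ : ZMod n) ∈ Q)
    (hq₂max : ∀ t ∈ Set.Ico 0 (k : ℤ), ((t : ZMod n) ∈ Q) → t ≤ q₂)
    (hgap : q₂ - q₁ < (n : ℤ) - k) :
    ((n : ℤ) - k - (q₂ - q₁) - 1) / ((k : ℤ) - r + 1) + 1 ≤
      ({B | M.IsBase B ∧ cyclicInterval n k 0 \ Q ⊆ B ∧
        ∃ i : ℤ, q₂ - q₁ < i ∧ i ≤ (n : ℤ) - k ∧
          B ⊆ (cyclicInterval n k 0 \ Q) ∪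
            (cyclicInterval n k (q₁ + i) \ cyclicInterval n k 0)}.ncard : ℤ) := by
  have : NeZero n := ⟨hn.ne'⟩
  have hbase := isBase_cyclicInterval hkn.le hE hrank hcyclic
  simp only [Set.mem_Ico] at hq₁mem hq₂mem
  have hQlift (x) (hx : x ∈ Q) : ∃ t : ℤ, q₁ ≤ t ∧ t ≤ q₂ ∧ (t : ZMod n) = x := by
    obtain ⟨t, ht, rfl⟩ := hQsub hx
    rw [zero_add] at ht
    exact ⟨t, hq₁min t ht hx, hq₂max t ht hx, rfl⟩
  have hq : q₁ ≤ q₂ := hq₁min q₂ (by simpa using hq₂mem) hq₂Q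
  have hdisj (i : ℤ) (hi : q₂ - q₁ < i) (hi' : i ≤ (n : ℤ) - k) :
      Disjoint (cyclicInterval n k (q₁ + i)) Q := by
    rw [Set.disjoint_left]
    rintro _ ⟨u, hu, rfl⟩ huQ
    obtain ⟨t, ht₁, ht₂, htu⟩ := hQlift _ huQ
    simp only [Set.mem_Ico] at hu htu
    have hdvd := (ZMod.intCast_eq_intCast_iff_dvd_sub t u n).1 htu
    have := Int.eq_zero_of_abs_lt_dvd hdvd (by rw [abs_lt]; omega)
    omega
  have hexists (i : ℤ) (hi : q₂ - q₁ < i) (hi' : i ≤ (n : ℤ) - k) :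
      ∃ B, M.IsBase B ∧ cyclicInterval n k 0 \ Q ⊆ B ∧ B ⊆ (cyclicInterval n k 0 \ Q) ∪
        (cyclicInterval n k (q₁ + i) \ cyclicInterval n k 0) := by
    obtain ⟨B, hB, hIB, hBsub⟩ := ((hbase 0).indep.subset
      (Set.sdiff_subset (t := Q))).exists_isBase_subset_union_isBase (hbase (q₁ + i))
    refine ⟨B, hB, hIB, fun x hx => ?_⟩
    have hxQ : x ∈ cyclicInterval n k (q₁ + i) → x ∉ Q :=
      fun h => Set.disjoint_left.1 (hdisj i hi hi') h
    have hxB := hBsub hx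
    simp only [Set.mem_union, Set.mem_sdiff] at hxB ⊢
    tauto
  choose! F hFbase hFsup hFsub using hexists
  have hdiff (i : ℤ) (hi : q₂ - q₁ < i) (hi' : i ≤ (n : ℤ) - k) :
      F i \ (cyclicInterval n k 0 \ Q) ⊆
        cyclicInterval n k (q₁ + i) \ cyclicInterval n k 0 :=
    Set.sdiff_subset_iff.2 (hFsub i hi hi')
  have hrk : r + (cyclicInterval n k 0 \ Q).ncard = k := by
    rw [← hr, add_comm, Set.ncard_sdiff_add_ncard_of_subset hQsub, ncard_cyclicInterval n k hkn.le]
  have hrpos : 0 < r := hr ▸ (Set.ncard_pos Q.toFinite).2 hQne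
  have hsep (i i' : ℤ) (hi : q₂ - q₁ < i) (hii' : i < i') (hi' : i' ≤ (n : ℤ) - k)
      (hF : F i = F i') : i' - i ≤ k - r := by
    have hsub := (Set.subset_inter (hdiff i hi (by omega))
      (hF ▸ hdiff i' (by omega) hi')).trans
        (cyclicInterval_diff_inter_subset (by omega) (by omega) (by omega) (by omega))
    have hle := (Set.ncard_le_ncard hsub (Set.toFinite _)).trans (ncard_cyclicInterval_le _ _ _)
    have hcard := Set.ncard_sdiff_add_ncard_of_subset (hFsup i hi (by omega))
    rw [hrank _ (hFbase i hi (by omega))] at hcard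
    omega
  set d : ℤ := (k : ℤ) - r + 1 with hd
  have hdpos : 0 < d := by omega
  set N : ℤ := (n : ℤ) - k - (q₂ - q₁) - 1 with hN
  have hm : 0 ≤ N / d := Int.ediv_nonneg (by omega) hdpos.le
  have hmN : N / d * d ≤ N := Int.ediv_mul_le _ hdpos.ne'
  have hbound (j : ℤ) (hj : j ∈ Set.Ico 0 (N / d + 1)) : 0 ≤ j * d ∧ j * d ≤ N := by
    simp only [Set.mem_Ico] at hj
    exact ⟨mul_nonneg hj.1 hdpos.le,
      (mul_le_mul_of_nonneg_right (by omega) hdpos.le).trans hmN⟩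
  let G : ℤ → Set (ZMod n) := fun j => F (q₂ - q₁ + 1 + j * d)
  have hne (a b : ℤ) (ha : a ∈ Set.Ico 0 (N / d + 1)) (hb : b ∈ Set.Ico 0 (N / d + 1))
      (hab : a < b) : G a ≠ G b := by
    intro h
    have ha' := hbound a ha
    have hb' := hbound b hb
    have hmul : (a + 1) * d ≤ b * d := mul_le_mul_of_nonneg_right (by omega) hdpos.le
    rw [add_mul, one_mul] at hmul
    have := hsep _ _ (by omega) (by omega) (by omega) h
    omega
  have hinj : Set.InjOn G (Set.Ico 0 (N / d + 1)) := by
    intro a ha b hb hab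
    rcases lt_trichotomy a b with h | h | h
    · exact absurd hab (hne a b ha hb h)
    · exact h
    · exact absurd hab.symm (hne b a hb ha h)
  have hcard := Set.ncard_le_ncard_of_injOn (t := {B | M.IsBase B ∧ cyclicInterval n k 0 \ Q ⊆ B ∧
        ∃ i : ℤ, q₂ - q₁ < i ∧ i ≤ (n : ℤ) - k ∧
          B ⊆ (cyclicInterval n k 0 \ Q) ∪
            (cyclicInterval n k (q₁ + i) \ cyclicInterval n k 0)}) G (fun j hj => by
      have hj' := hbound j hj
      exact ⟨hFbase _ (by omega) (by omega), hFsup _ (by omega) (by omega), _, by omega, by omega,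
        hFsub _ (by omega) (by omega)⟩) hinj (Set.toFinite _)
  rw [← Finset.coe_Ico, Set.ncard_coe_finset, Int.card_Ico] at hcard
  omega
end

section
/- (Remark 2.3, uniqueness for rank n−1) Let n be a positive integer and let M be a cyclic (n−1)-matroid on ℤ_n. Then every subset of ℤ_n of cardinality n−1 is a base of M; i.e., M is the uniform matroid U_{n,n−1}. -/
theorem Set.exists_eq_compl_singleton_of_ncard_eq {n : ℕ} (hn : 0 < n) {A : Set (ZMod n)}
    (hA : A.ncard = n - 1) : ∃ a, A = {a}ᶜ := by
  have : NeZero n := ⟨hn.ne'⟩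
  have h := Set.ncard_add_ncard_compl A
  rw [Nat.card_zmod, hA] at h
  obtain ⟨a, ha⟩ := Set.ncard_eq_one.1 (show Aᶜ.ncard = 1 by omega)
  exact ⟨a, by rw [← ha, compl_compl]⟩

/-- (Remark 2.3) A cyclic `(n-1)`-matroid on `ℤ_n` is the uniform matroid `U_{n,n-1}`:
every subset of `ℤ_n` of cardinality `n-1` is a base. -/
theorem cyclic_matroid_rank_sub_one_uniform (n : ℕ) (hn : 0 < n)
    (M : Matroid (ZMod n)) (hE : M.E = Set.univ)
    (hrank : ∀ B, M.IsBase B → B.ncard = n - 1)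
    (hcyclic : ∀ B, M.IsBase B → ∀ s : ZMod n, M.IsBase ((fun a => a + s) '' B)) :
    ∀ A : Set (ZMod n), A.ncard = n - 1 → M.IsBase A := by
  intro A hA
  obtain ⟨B, hB⟩ := M.exists_isBase
  obtain ⟨a, rfl⟩ := Set.exists_eq_compl_singleton_of_ncard_eq hn hA
  obtain ⟨b, rfl⟩ := Set.exists_eq_compl_singleton_of_ncard_eq hn (hrank B hB)
  have h := hcyclic _ hB (a - b)
  rwa [Set.image_compl_eq (AddGroup.addRight_bijective (a - b)), Set.image_singleton,
    add_sub_cancel] at h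
end
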